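/- For every $I=(I_1,\dots,I_d)\in\mathcal{I}_d$: (i) for every permutation $\sigma$ of $\{1,\dots,d\}$ one has $\omega_{(I_{\sigma(1)},\dots,I_{\sigma(d)})}=\mathrm{sgn}(\sigma)\,\omega_I$; (ii) replacing one entry $(i_l,j_l)$ of $I$ by the reversed pair $(j_l,i_l)$ changes $\omega_I$ into $-\omega_I$; (iii) consequently $\omega_I=0$ whenever two entries of $I$ coincide as 2-element subsets of $\{1,\dots,5\}$. In particular, the assignment $x_{I_1}\wedge\cdots\wedge x_{I_d}\mapsto\omega_I$ extends to a well-defined $\mathbb{C}$-linear map $\Lambda^d V\to A$, where $V$ is the 10-dimensional vector space with basis $\{x_{(i,j)}:1\le i<j\le 5\}$ and $x_{(j,i)}=-x_{(i,j)}$. -/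

import Mathlib

open scoped Classical

noncomputable section
/-- The complementary index `t_{ijkl}`: the unique element of `Fin 5` not among
distinct `i,j,k,l` (garbage value otherwise, where `eps` vanishes anyway). -/
def tIdx (i j k l : Fin 5) : Fin 5 :=
  ⟨(10 - (i.val + j.val + k.val + l.val)) % 5, Nat.mod_lt _ (by norm_num)⟩

/-- The sign `ε_{ijkl}`: the sign of the permutation `(i,j,k,l,t_{ijkl})` of `Fin 5`
if `i,j,k,l` are pairwise distinct, and `0` otherwise (Levi-Civita formula). -/
def eps (i j k l : Fin 5) : ℤ :=
  ∏ q : Fin 5, ∏ p ∈ Finset.univ.filter (fun p => p < q),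
    Int.sign ((![(i.val : ℤ), (j.val : ℤ), (k.val : ℤ), (l.val : ℤ), ((tIdx i j k l).val : ℤ)]) q -
      (![(i.val : ℤ), (j.val : ℤ), (k.val : ℤ), (l.val : ℤ), ((tIdx i j k l).val : ℤ)]) p)

/-- A unital associative `ℂ`-algebra `A` together with elements `d i j` and `∂ t`
satisfying the defining relations of `U_- = U(g_{-1} ⊕ g_{-2})` for `E(5,10)`. -/
structure E510Rep (A : Type*) [Ring A] [Algebra ℂ A] where
  d : Fin 5 → Fin 5 → A
  p : Fin 5 → A
  d_antisymm : ∀ i j, d i j = - d j i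
  pd_comm : ∀ t i j, p t * d i j = d i j * p t
  pp_comm : ∀ s t, p s * p t = p t * p s
  dd_rel : ∀ i j k l, d i j * d k l + d k l * d i j = eps i j k l • p (tIdx i j k l)

/-- Self-intersection free families of position pairs (each pair recorded as an
ordered pair `(k,l)` with `k < l`; the pairs are pairwise disjoint). -/
def isSIF {n : ℕ} (S : Finset (Fin n × Fin n)) : Prop :=
  (∀ q ∈ S, q.1 < q.2) ∧
    ∀ q ∈ S, ∀ q' ∈ S, q ≠ q' → q.1 ≠ q'.1 ∧ q.1 ≠ q'.2 ∧ q.2 ≠ q'.1 ∧ q.2 ≠ q'.2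

/-- Two disjoint pairs cross if exactly one member of one lies strictly between
the members of the other. -/
def crosses {n : ℕ} (q q' : Fin n × Fin n) : Prop :=
  (q.1 < q'.1 ∧ q'.1 < q.2 ∧ q.2 < q'.2) ∨ (q'.1 < q.1 ∧ q.1 < q'.2 ∧ q'.2 < q.2)

/-- The crossing number `c(S)`: the number of (unordered) pairs of elements of `S`
that cross (each counted once, using the order of first components). -/
def crossNum {n : ℕ} (S : Finset (Fin n × Fin n)) : ℕ :=
  ((S ×ˢ S).filter (fun z => z.1.1 < z.2.1 ∧ crosses z.1 z.2)).card

/-- The scalar part of `D_S(I)`: the product over `{k,l} ∈ S` of `(1/2)(-1)^{k+l} ε_{I_k,I_l}`. -/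
def DScalar {n : ℕ} (I : Fin n → Fin 5 × Fin 5) (S : Finset (Fin n × Fin n)) : ℂ :=
  ∏ q ∈ S, ((-1 : ℂ) ^ (q.1.val + q.2.val) *
    ((eps (I q.1).1 (I q.1).2 (I q.2).1 (I q.2).2 : ℤ) : ℂ) / 2)

/-- The multiplicity of `∂ t` in `D_S(I)`. -/
def pCount {n : ℕ} (I : Fin n → Fin 5 × Fin 5) (S : Finset (Fin n × Fin n)) (t : Fin 5) : ℕ :=
  (S.filter (fun q => tIdx (I q.1).1 (I q.1).2 (I q.2).1 (I q.2).2 = t)).card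

section Alg

variable {A : Type*} [Ring A] [Algebra ℂ A]

/-- The monomial `∂^M = ∂_1^{m_1} ⋯ ∂_5^{m_5}`. -/
def pMono (pp : Fin 5 → A) (c : Fin 5 → ℕ) : A :=
  pp 0 ^ c 0 * pp 1 ^ c 1 * pp 2 ^ c 2 * pp 3 ^ c 3 * pp 4 ^ c 4

/-- `d_{C_S(I)}`: the ordered product of the `d`'s over the positions of `I`
not covered by `S`. -/
def dRest (dd : Fin 5 → Fin 5 → A) {n : ℕ} (I : Fin n → Fin 5 × Fin 5)
    (S : Finset (Fin n × Fin n)) : A :=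
  (((Finset.univ.filter (fun i : Fin n => ∀ q ∈ S, i ≠ q.1 ∧ i ≠ q.2)).sort (· ≤ ·)).map
    (fun i => dd (I i).1 (I i).2)).prod

/-- The summand `(-1)^{c(S)} D_S(I) d_{C_S(I)}` of `ω_I` (here `D_S(I)` is written as
its scalar part times the corresponding `∂`-monomial, to which it is equal since
the `∂`'s commute). -/
def omegaBody (dd : Fin 5 → Fin 5 → A) (pp : Fin 5 → A) {n : ℕ}
    (I : Fin n → Fin 5 × Fin 5) (S : Finset (Fin n × Fin n)) : A :=
  ((-1 : ℂ) ^ crossNum S * DScalar I S) • (pMono pp (pCount I S) * dRest dd I S)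

/-- `ω_I = ∑_{S SIF} (-1)^{c(S)} D_S(I) d_{C_S(I)}`. -/
def omegaOf (dd : Fin 5 → Fin 5 → A) (pp : Fin 5 → A) {n : ℕ} (I : Fin n → Fin 5 × Fin 5) : A :=
  ∑ S : Finset (Fin n × Fin n), if isSIF S then omegaBody dd pp I S else 0

end Alg
/-- The 10-dimensional space `Λ²ℂ⁵` with basis `x_{(i,j)}`, `i < j`. -/
abbrev V10 : Type := {q : Fin 5 × Fin 5 // q.1 < q.2} → ℂ

/-- `x_{(i,j)}` for an arbitrary ordered pair, with `x_{(j,i)} = -x_{(i,j)}`. -/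
def xvec (q : Fin 5 × Fin 5) : V10 :=
  if h : q.1 < q.2 then Pi.single (⟨q, h⟩ : {q : Fin 5 × Fin 5 // q.1 < q.2}) (1 : ℂ)
  else if h : q.2 < q.1 then
    -(Pi.single (⟨(q.2, q.1), h⟩ : {q : Fin 5 × Fin 5 // q.1 < q.2}) (1 : ℂ))
  else 0

/-- `x_I = x_{I_1} ∧ ⋯ ∧ x_{I_d}` in the exterior algebra of `V10`. -/
def xwedge {n : ℕ} (I : Fin n → Fin 5 × Fin 5) : ExteriorAlgebra ℂ V10 :=
  (List.ofFn (fun a => ExteriorAlgebra.ι ℂ (xvec (I a)))).prod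

/-- `ω_{I ∖ (J_1,…,J_m)}`: equal to `ω_K` for any `K` with `x_I = x_J ∧ x_K`
(well defined up to the alternating relations), and `0` if no such `K` exists. -/
def omegaDel {A : Type*} [Ring A] [Algebra ℂ A] (dd : Fin 5 → Fin 5 → A) (pp : Fin 5 → A)
    {n m : ℕ} (I : Fin n → Fin 5 × Fin 5) (J : Fin m → Fin 5 × Fin 5) : A :=
  if h : ∃ K : Fin (n - m) → Fin 5 × Fin 5, xwedge I = xwedge J * xwedge K then
    omegaOf dd pp (Classical.choose h)
  else 0
section Wick

open CliffordAlgebra in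
/-- If `D x ^ 2 = B x x`, the linear map on the exterior algebra obtained from `D` by Wick ordering
with respect to the bilinear form `B`. -/
theorem exists_wick_map {C E M : Type*} [CommRing C] [Ring E] [Algebra C E] [AddCommGroup M]
    [Module C M] (D : M →ₗ[C] E) (B : LinearMap.BilinForm C M)
    (hD : ∀ x, D x * D x = algebraMap C E (B x x)) :
    ∃ g : ExteriorAlgebra C M →ₗ[C] E, g 1 = 1 ∧
      ∀ m x, g (ExteriorAlgebra.ι C m * x) = D m * g x - g (contractLeft (B m) x) := by
  have h : B.toQuadraticMap = B.toQuadraticMap - 0 := (sub_zero _).symm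
  let L : CliffordAlgebra B.toQuadraticMap →ₐ[C] E := CliffordAlgebra.lift _ ⟨D, hD⟩
  refine ⟨L.toLinearMap ∘ₗ changeForm h, ?_, fun m x => ?_⟩
  · simp
  · have h1 := changeForm_ι_mul h m x
    have h2 := changeForm_contractLeft h (B m) x
    simp only [LinearMap.comp_apply, AlgHom.toLinearMap_apply]
    have h3 : L (CliffordAlgebra.ι _ m) = D m := CliffordAlgebra.lift_ι_apply _ _ _
    rw [ExteriorAlgebra.ι, h1, ← h2, map_sub, map_mul, h3]

/-- Contraction of a product of vectors, as an alternating sum over the omitted factor. -/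
theorem contractLeft_prod_ofFn {C M : Type*} [CommRing C] [AddCommGroup M] [Module C M]
    (φ : Module.Dual C M) {n : ℕ} (v : Fin (n + 1) → M) :
    CliffordAlgebra.contractLeft (Q := 0) φ
        (List.ofFn fun i => ExteriorAlgebra.ι C (v i)).prod =
      ∑ l : Fin (n + 1), ((-1) ^ l.val * φ (v l)) •
        (List.ofFn fun i => ExteriorAlgebra.ι C (v (l.succAbove i))).prod := by
  induction n with
  | zero => simp [ExteriorAlgebra.ι, Algebra.algebraMap_eq_smul_one]
  | succ n ih =>
    rw [List.ofFn_succ, List.prod_cons, Fin.sum_univ_succ]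
    have h := CliffordAlgebra.contractLeft_ι_mul (Q := (0 : QuadraticForm C M)) φ (v 0)
      (List.ofFn fun i : Fin (n + 1) => ExteriorAlgebra.ι C (v i.succ)).prod
    refine h.trans ?_
    rw [ih (fun i => v i.succ)]
    simp only [Finset.mul_sum, Fin.succAbove_zero, List.ofFn_succ (n := n), Fin.succ_succAbove_succ,
      Fin.succ_succAbove_zero, List.prod_cons, Fin.val_zero, pow_zero, one_mul, Fin.val_succ,
      sub_eq_add_neg, ← Finset.sum_neg_distrib]
    congr 1
    refine Finset.sum_congr rfl fun l _ => ?_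
    rw [pow_succ, ExteriorAlgebra.ι, mul_smul_comm, ← neg_smul]
    congr 1
    ring

end Wick

section Matchings

/-- The ordered product of the `a i` over the positions `i` not covered by `S`. -/
def unmatchedProd {A : Type*} [Ring A] {n : ℕ} (a : Fin n → A) (S : Finset (Fin n × Fin n)) : A :=
  (((Finset.univ.filter (fun i : Fin n => ∀ q ∈ S, i ≠ q.1 ∧ i ≠ q.2)).sort (· ≤ ·)).map a).prod

/-- The signed weight of the family `S` for the pair weights `b`. -/
def matchingWeight {C : Type*} [CommRing C] {n : ℕ} (b : Fin n → Fin n → C)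
    (S : Finset (Fin n × Fin n)) : C :=
  (-1) ^ crossNum S * ∏ q ∈ S, ((-1) ^ (q.1.val + q.2.val) * b q.1 q.2)

/-- The sum over self-intersection free families of the weight times the remaining product. -/
def matchingSum {C A : Type*} [CommRing C] [Ring A] [Algebra C A] {n : ℕ} (a : Fin n → A)
    (b : Fin n → Fin n → C) : A :=
  ∑ S : Finset (Fin n × Fin n) with isSIF S, matchingWeight b S • unmatchedProd a S

/-- The image of a family of pairs under an order embedding of positions. -/
def mapPairs {m n : ℕ} (e : Fin m ↪o Fin n) (T : Finset (Fin m × Fin m)) :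
    Finset (Fin n × Fin n) :=
  T.map (e.toEmbedding.prodMap e.toEmbedding)

variable {m n : ℕ}

theorem mem_mapPairs {e : Fin m ↪o Fin n} {T : Finset (Fin m × Fin m)} {q : Fin n × Fin n} :
    q ∈ mapPairs e T ↔ ∃ p ∈ T, (e p.1, e p.2) = q := by
  simp [mapPairs]

theorem forall_mem_mapPairs {e : Fin m ↪o Fin n} {T : Finset (Fin m × Fin m)}
    {P : Fin n × Fin n → Prop} : (∀ q ∈ mapPairs e T, P q) ↔ ∀ p ∈ T, P (e p.1, e p.2) := by
  simp only [mapPairs, Finset.forall_mem_map]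
  rfl

theorem prod_mapPairs {C : Type*} [CommMonoid C] (e : Fin m ↪o Fin n)
    (T : Finset (Fin m × Fin m)) (f : Fin n × Fin n → C) :
    ∏ q ∈ mapPairs e T, f q = ∏ p ∈ T, f (e p.1, e p.2) :=
  Finset.prod_map _ _ _

theorem sum_mapPairs {C : Type*} [AddCommMonoid C] (e : Fin m ↪o Fin n)
    (T : Finset (Fin m × Fin m)) (f : Fin n × Fin n → C) :
    ∑ q ∈ mapPairs e T, f q = ∑ p ∈ T, f (e p.1, e p.2) :=
  Finset.sum_map _ _ _

theorem mapPairs_injective (e : Fin m ↪o Fin n) : Function.Injective (mapPairs e) :=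
  Finset.map_injective _

theorem isSIF_mapPairs (e : Fin m ↪o Fin n) (T : Finset (Fin m × Fin m)) :
    isSIF (mapPairs e T) ↔ isSIF T := by
  simp only [isSIF, forall_mem_mapPairs, e.lt_iff_lt, Ne, Prod.ext_iff, e.eq_iff_eq]

theorem exists_mapPairs_eq (e : Fin m ↪o Fin n) (S : Finset (Fin n × Fin n))
    (hS : ∀ q ∈ S, q.1 ∈ Set.range e ∧ q.2 ∈ Set.range e) : ∃ T, mapPairs e T = S := by
  refine ⟨Finset.univ.filter fun p => (e p.1, e p.2) ∈ S, ?_⟩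
  ext q
  rw [mem_mapPairs]
  constructor
  · rintro ⟨p, hp, rfl⟩
    simpa using hp
  · intro hq
    obtain ⟨⟨x, hx⟩, y, hy⟩ := hS q hq
    have hxy : (e x, e y) = q := Prod.ext hx hy
    exact ⟨(x, y), by simpa [hxy] using hq, hxy⟩

theorem crossNum_eq_sum (S : Finset (Fin n × Fin n)) :
    crossNum S = ∑ z ∈ S, ∑ w ∈ S, if z.1 < w.1 ∧ crosses z w then 1 else 0 := by
  rw [crossNum, Finset.card_filter, Finset.sum_product]

theorem crosses_map (e : Fin m ↪o Fin n) (p q : Fin m × Fin m) :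
    crosses (e p.1, e p.2) (e q.1, e q.2) ↔ crosses p q := by
  simp only [crosses, e.lt_iff_lt]

theorem crossNum_mapPairs (e : Fin m ↪o Fin n) (T : Finset (Fin m × Fin m)) :
    crossNum (mapPairs e T) = crossNum T := by
  simp only [crossNum_eq_sum, sum_mapPairs, crosses_map, e.lt_iff_lt]

theorem sort_map_orderEmb (e : Fin m ↪o Fin n) (s : Finset (Fin m)) :
    (s.map e.toEmbedding).sort (· ≤ ·) = (s.sort (· ≤ ·)).map e :=
  (Finset.map_sort e.toEmbedding s (· ≤ ·) (· ≤ ·)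
    fun a _ b _ => (e.le_iff_le (a := a) (b := b)).symm).symm

section Free

variable {C A : Type*} [CommRing C] [Ring A] [Algebra C A]

theorem unmatchedProd_mapPairs_succ (a : Fin (n + 1) → A) (T : Finset (Fin n × Fin n)) :
    unmatchedProd a (mapPairs (Fin.succOrderEmb n) T) =
      a 0 * unmatchedProd (fun i => a i.succ) T := by
  have h : (Finset.univ.filter fun i : Fin (n + 1) =>
      ∀ q ∈ mapPairs (Fin.succOrderEmb n) T, i ≠ q.1 ∧ i ≠ q.2) =
      insert 0 ((Finset.univ.filter fun i : Fin n => ∀ q ∈ T, i ≠ q.1 ∧ i ≠ q.2).map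
        (Fin.succOrderEmb n).toEmbedding) := by
    ext i
    rw [Finset.mem_filter, forall_mem_mapPairs]
    refine Fin.cases ?_ (fun i => ?_) i
    · simp [(Fin.succ_ne_zero _).symm]
    · simp
  rw [unmatchedProd, h, Finset.sort_insert _ (by simp) (by simp), sort_map_orderEmb]
  simp [unmatchedProd, Function.comp_def]

theorem matchingWeight_mapPairs_succ (b : Fin (n + 1) → Fin (n + 1) → C)
    (T : Finset (Fin n × Fin n)) :
    matchingWeight b (mapPairs (Fin.succOrderEmb n) T) =
      matchingWeight (fun i j => b i.succ j.succ) T := by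
  rw [matchingWeight, crossNum_mapPairs, matchingWeight, prod_mapPairs]
  congr 1
  refine Finset.prod_congr rfl fun q _ => ?_
  simp only [Fin.coe_succOrderEmb, Fin.val_succ]
  congr 1
  ring

theorem sum_unmatched_zero (a : Fin (n + 1) → A) (b : Fin (n + 1) → Fin (n + 1) → C) :
    ∑ S : Finset (Fin (n + 1) × Fin (n + 1)) with isSIF S ∧ ∀ q ∈ S, q.1 ≠ 0,
        matchingWeight b S • unmatchedProd a S =
      a 0 * matchingSum (fun i => a i.succ) (fun i j => b i.succ j.succ) := by
  rw [matchingSum, Finset.mul_sum]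
  symm
  refine Finset.sum_nbij (mapPairs (Fin.succOrderEmb n)) ?_ (mapPairs_injective _).injOn ?_ ?_
  · intro T hT
    simp only [Finset.mem_filter, Finset.mem_univ, true_and, isSIF_mapPairs] at hT ⊢
    exact ⟨hT, forall_mem_mapPairs.2 fun p _ => Fin.succ_ne_zero _⟩
  · intro S hS
    simp only [Finset.coe_filter, Finset.mem_univ, true_and, Set.mem_ofPred_eq] at hS
    obtain ⟨T, rfl⟩ := exists_mapPairs_eq (Fin.succOrderEmb n) S fun q hq => by
      have h1 := hS.2 q hq
      have h2 := hS.1.1 q hq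
      simp only [Fin.coe_succOrderEmb, Fin.range_succ, Set.mem_compl_iff, Set.mem_singleton_iff]
      exact ⟨h1, (lt_of_le_of_lt (Fin.zero_le _) h2).ne'⟩
    exact ⟨T, by simpa [isSIF_mapPairs] using hS.1, rfl⟩
  · intro T _
    rw [unmatchedProd_mapPairs_succ, matchingWeight_mapPairs_succ, mul_smul_comm]

end Free

section Bound

variable {C A : Type*} [CommRing C] [Ring A] [Algebra C A]

/-- The order embedding of `Fin n` in `Fin (n + 2)` omitting `0` and `l.succ`. -/
def skipZeroSucc (l : Fin (n + 1)) : Fin n ↪o Fin (n + 2) :=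
  (Fin.succAboveOrderEmb l).trans (Fin.succOrderEmb (n + 1))

theorem skipZeroSucc_apply (l : Fin (n + 1)) (i : Fin n) :
    skipZeroSucc l i = (l.succAbove i).succ := rfl

theorem skipZeroSucc_ne_zero (l : Fin (n + 1)) (i : Fin n) : skipZeroSucc l i ≠ 0 :=
  Fin.succ_ne_zero _

theorem skipZeroSucc_ne_succ (l : Fin (n + 1)) (i : Fin n) : skipZeroSucc l i ≠ l.succ := by
  rw [skipZeroSucc_apply, Ne, Fin.succ_inj]
  exact Fin.succAbove_ne l i

theorem mem_range_skipZeroSucc {l : Fin (n + 1)} {x : Fin (n + 2)} (h0 : x ≠ 0)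
    (hl : x ≠ l.succ) : x ∈ Set.range (skipZeroSucc l) := by
  obtain ⟨y, rfl⟩ := Fin.exists_succ_eq.2 h0
  obtain ⟨z, rfl⟩ := Fin.exists_succAbove_eq (x := y) (y := l) (by rintro rfl; exact hl rfl)
  exact ⟨z, rfl⟩

/-- The family of pairs obtained by adjoining `(0, l.succ)` to a family on the other positions. -/
def insertPair (l : Fin (n + 1)) (T : Finset (Fin n × Fin n)) :
    Finset (Fin (n + 2) × Fin (n + 2)) :=
  insert (0, l.succ) (mapPairs (skipZeroSucc l) T)

theorem pair_notMem_mapPairs (l : Fin (n + 1)) (T : Finset (Fin n × Fin n)) (x : Fin (n + 2)) :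
    (0, x) ∉ mapPairs (skipZeroSucc l) T := by
  rw [mem_mapPairs]
  rintro ⟨p, -, hp⟩
  exact skipZeroSucc_ne_zero l p.1 (congrArg Prod.fst hp)

theorem insertPair_injective (l : Fin (n + 1)) : Function.Injective (insertPair l) := by
  intro T T' h
  apply mapPairs_injective (skipZeroSucc l)
  have := congrArg (fun S => S.erase (0, l.succ)) h
  simpa [insertPair, Finset.erase_insert, pair_notMem_mapPairs] using this

theorem isSIF_insertPair (l : Fin (n + 1)) (T : Finset (Fin n × Fin n)) :
    isSIF (insertPair l T) ↔ isSIF T := by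
  rw [← isSIF_mapPairs (skipZeroSucc l) T]
  constructor
  · rintro ⟨h1, h2⟩
    exact ⟨fun q hq => h1 q (Finset.mem_insert_of_mem hq), fun q hq q' hq' =>
      h2 q (Finset.mem_insert_of_mem hq) q' (Finset.mem_insert_of_mem hq')⟩
  · rintro ⟨h1, h2⟩
    have key : ∀ q ∈ mapPairs (skipZeroSucc l) T,
        q.1 ≠ 0 ∧ q.2 ≠ 0 ∧ q.1 ≠ l.succ ∧ q.2 ≠ l.succ := by
      intro q hq
      obtain ⟨p, -, rfl⟩ := mem_mapPairs.1 hq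
      exact ⟨skipZeroSucc_ne_zero _ _, skipZeroSucc_ne_zero _ _, skipZeroSucc_ne_succ _ _,
        skipZeroSucc_ne_succ _ _⟩
    constructor
    · intro q hq
      rcases Finset.mem_insert.1 hq with rfl | hq
      · exact Fin.succ_pos l
      · exact h1 q hq
    · intro q hq q' hq' hne
      rcases Finset.mem_insert.1 hq with rfl | hq <;> rcases Finset.mem_insert.1 hq' with rfl | hq'
      · exact absurd rfl hne
      · have := key q' hq'
        exact ⟨this.1.symm, this.2.1.symm, this.2.2.1.symm, this.2.2.2.symm⟩
      · have := key q hq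
        exact ⟨this.1, this.2.2.1, this.2.1, this.2.2.2⟩
      · exact h2 q hq q' hq' hne

theorem unmatchedProd_insertPair (a : Fin (n + 2) → A) (l : Fin (n + 1))
    (T : Finset (Fin n × Fin n)) :
    unmatchedProd a (insertPair l T) = unmatchedProd (fun i => a (skipZeroSucc l i)) T := by
  have h : (Finset.univ.filter fun i : Fin (n + 2) =>
      ∀ q ∈ insertPair l T, i ≠ q.1 ∧ i ≠ q.2) =
      (Finset.univ.filter fun i : Fin n => ∀ q ∈ T, i ≠ q.1 ∧ i ≠ q.2).map
        (skipZeroSucc l).toEmbedding := by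
    ext i
    by_cases hi : i ∈ Set.range (skipZeroSucc l)
    · obtain ⟨j, rfl⟩ := hi
      simp only [insertPair, Finset.mem_filter, Finset.forall_mem_insert, forall_mem_mapPairs]
      simp [skipZeroSucc_ne_zero, skipZeroSucc_ne_succ]
    · have h1 : ∀ j, skipZeroSucc l j ≠ i := fun j hj => hi ⟨j, hj⟩
      have h2 : i = 0 ∨ i = l.succ := by
        by_contra hcon
        push Not at hcon
        exact hi (mem_range_skipZeroSucc hcon.1 hcon.2)
      simp only [insertPair, Finset.mem_filter, Finset.mem_univ, true_and, Finset.mem_insert,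
        Finset.mem_map, RelEmbedding.coe_toEmbedding, h1, and_false, exists_false, iff_false]
      intro hall
      have := hall _ (Or.inl rfl)
      tauto
  rw [unmatchedProd, h, sort_map_orderEmb]
  simp [unmatchedProd, Function.comp_def]

theorem crossNum_insertPair (l : Fin (n + 1)) {T : Finset (Fin n × Fin n)} :
    crossNum (insertPair l T) = (∑ q ∈ T,
      if skipZeroSucc l q.1 < l.succ ∧ l.succ < skipZeroSucc l q.2 then 1 else 0) + crossNum T := by
  have hpos : ∀ i, (0 : Fin (n + 2)) < skipZeroSucc l i := fun i => Fin.succ_pos _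
  rw [crossNum_eq_sum, crossNum_eq_sum, insertPair, Finset.sum_insert (pair_notMem_mapPairs _ _ _)]
  simp_rw [Finset.sum_insert (pair_notMem_mapPairs _ _ _)]
  have h1 : ∀ i j, crosses (0, l.succ) (skipZeroSucc l i, skipZeroSucc l j) ↔
      skipZeroSucc l i < l.succ ∧ l.succ < skipZeroSucc l j := fun i j => by
    simp [crosses, hpos]
  simp [sum_mapPairs, -Finset.sum_boole, crosses_map, h1, hpos]

theorem neg_one_pow_skipZeroSucc (l : Fin (n + 1)) {x y : Fin n} (hxy : x < y) :
    (-1 : C) ^ (if skipZeroSucc l x < l.succ ∧ l.succ < skipZeroSucc l y then 1 else 0) *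
      (-1) ^ ((skipZeroSucc l x).val + (skipZeroSucc l y).val) = (-1) ^ (x.val + y.val) := by
  rw [← pow_add]
  have hxy' : x.val < y.val := hxy
  refine neg_one_pow_congr ?_
  simp only [skipZeroSucc_apply, Fin.lt_def, Fin.val_succ, Fin.succAbove,
    Fin.val_castSucc]
  split_ifs <;> simp_all [Nat.even_iff] <;> omega

theorem matchingWeight_insertPair (b : Fin (n + 2) → Fin (n + 2) → C) (l : Fin (n + 1))
    {T : Finset (Fin n × Fin n)} (hT : isSIF T) :
    matchingWeight b (insertPair l T) = ((-1) ^ (l.val + 1) * b 0 l.succ) *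
      matchingWeight (fun i j => b (skipZeroSucc l i) (skipZeroSucc l j)) T := by
  rw [matchingWeight, crossNum_insertPair, matchingWeight, insertPair,
    Finset.prod_insert (pair_notMem_mapPairs _ _ _), prod_mapPairs, pow_add,
    ← Finset.prod_pow_eq_pow_sum]
  have h : ∏ q ∈ T, ((-1 : C) ^ (q.1.val + q.2.val) *
        b (skipZeroSucc l q.1) (skipZeroSucc l q.2)) =
      (∏ q ∈ T, (-1 : C) ^
        (if skipZeroSucc l q.1 < l.succ ∧ l.succ < skipZeroSucc l q.2 then 1 else 0)) *
      ∏ q ∈ T, ((-1 : C) ^ ((skipZeroSucc l q.1).val + (skipZeroSucc l q.2).val) *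
        b (skipZeroSucc l q.1) (skipZeroSucc l q.2)) := by
    rw [← Finset.prod_mul_distrib]
    refine Finset.prod_congr rfl fun q hq => ?_
    rw [← mul_assoc, neg_one_pow_skipZeroSucc l (hT.1 q hq)]
  rw [h]
  simp only [Fin.val_zero, Fin.val_succ, zero_add]
  ring

theorem sum_matched_zero (a : Fin (n + 2) → A) (b : Fin (n + 2) → Fin (n + 2) → C)
    (l : Fin (n + 1)) :
    ∑ S : Finset (Fin (n + 2) × Fin (n + 2)) with isSIF S ∧ (0, l.succ) ∈ S,
        matchingWeight b S • unmatchedProd a S =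
      ((-1) ^ (l.val + 1) * b 0 l.succ) • matchingSum (fun i => a (l.succAbove i).succ)
        (fun i j => b (l.succAbove i).succ (l.succAbove j).succ) := by
  rw [matchingSum, Finset.smul_sum]
  symm
  refine Finset.sum_nbij (insertPair l) ?_ (insertPair_injective _).injOn ?_ ?_
  · intro T hT
    simp only [Finset.mem_filter, Finset.mem_univ, true_and, isSIF_insertPair] at hT ⊢
    exact ⟨hT, by simp [insertPair]⟩
  · intro S hS
    simp only [Finset.coe_filter, Finset.mem_univ, true_and, Set.mem_ofPred_eq] at hS
    obtain ⟨T, hT⟩ := exists_mapPairs_eq (skipZeroSucc l) (S.erase (0, l.succ)) fun q hq => by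
      obtain ⟨hne, hq⟩ := Finset.mem_erase.1 hq
      obtain ⟨h1, h2, h3, h4⟩ := hS.1.2 q hq _ hS.2 hne
      exact ⟨mem_range_skipZeroSucc h1 h2, mem_range_skipZeroSucc h3 h4⟩
    have hTS : insertPair l T = S := by rw [insertPair, hT, Finset.insert_erase hS.2]
    refine ⟨T, ?_, hTS⟩
    rw [← hTS, isSIF_insertPair] at hS
    simpa using hS.1
  · intro T hT
    rw [unmatchedProd_insertPair, matchingWeight_insertPair b l (by simpa using hT),
      mul_smul _ (matchingWeight _ T)]
    rfl

end Bound

section Recursion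

variable {C A : Type*} [CommRing C] [Ring A] [Algebra C A]

theorem matchingSum_eq_add (a : Fin (n + 1) → A) (b : Fin (n + 1) → Fin (n + 1) → C) :
    matchingSum a b = a 0 * matchingSum (fun i => a i.succ) (fun i j => b i.succ j.succ) +
      ∑ l : Fin n, ∑ S : Finset (Fin (n + 1) × Fin (n + 1)) with isSIF S ∧ (0, l.succ) ∈ S,
        matchingWeight b S • unmatchedProd a S := by
  rw [← sum_unmatched_zero, ← Finset.sum_biUnion, ← Finset.sum_union]
  · refine Finset.sum_congr ?_ fun _ _ => rfl
    ext S
    simp only [Finset.mem_filter, Finset.mem_univ, true_and, Finset.mem_union, Finset.mem_biUnion]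
    constructor
    · intro hS
      by_cases h : ∀ q ∈ S, q.1 ≠ 0
      · exact Or.inl ⟨hS, h⟩
      · push Not at h
        obtain ⟨⟨x, y⟩, hq, rfl : x = 0⟩ := h
        obtain ⟨l, rfl⟩ := Fin.exists_succ_eq.2 (hS.1 _ hq).ne'
        exact Or.inr ⟨l, hS, hq⟩
    · rintro (h | ⟨l, h⟩) <;> exact h.1
  · rw [Finset.disjoint_left]
    intro S hS hS'
    simp only [Finset.mem_filter, Finset.mem_univ, true_and, Finset.mem_biUnion] at hS hS'
    obtain ⟨l, -, hl⟩ := hS'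
    exact hS.2 _ hl rfl
  · intro l _ l' _ hne
    rw [Function.onFun, Finset.disjoint_left]
    intro S hS hS'
    simp only [Finset.mem_filter, Finset.mem_univ, true_and] at hS hS'
    have := hS.1.2 _ hS.2 _ hS'.2 (by simpa using hne)
    exact this.1 rfl

theorem matchingSum_zero (a : Fin 0 → A) (b : Fin 0 → Fin 0 → C) : matchingSum a b = 1 := by
  rw [matchingSum, Finset.sum_filter, Finset.sum_eq_single ∅]
  · simp [isSIF, matchingWeight, crossNum, unmatchedProd]
  · intro S _ hS
    exact absurd (Subsingleton.elim _ _) hS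
  · exact fun h => absurd (Finset.mem_univ _) h

theorem matchingSum_one (a : Fin 1 → A) (b : Fin 1 → Fin 1 → C) : matchingSum a b = a 0 := by
  rw [matchingSum_eq_add, matchingSum_zero]
  simp

theorem matchingSum_succ_succ (a : Fin (n + 2) → A) (b : Fin (n + 2) → Fin (n + 2) → C) :
    matchingSum a b = a 0 * matchingSum (fun i => a i.succ) (fun i j => b i.succ j.succ) +
      ∑ l : Fin (n + 1), ((-1) ^ (l.val + 1) * b 0 l.succ) •
        matchingSum (fun i => a (l.succAbove i).succ)
          (fun i j => b (l.succAbove i).succ (l.succAbove j).succ) := by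
  rw [matchingSum_eq_add]
  simp_rw [sum_matched_zero]

end Recursion

end Matchings

section Omega

theorem xwedge_eq_ιMulti {n : ℕ} (I : Fin n → Fin 5 × Fin 5) :
    xwedge I = ExteriorAlgebra.ιMulti ℂ n (fun a => xvec (I a)) := rfl

theorem xvec_swap (q : Fin 5 × Fin 5) : xvec (q.2, q.1) = -xvec q := by
  rcases lt_trichotomy q.1 q.2 with h | h | h
  · simp [xvec, h, h.not_gt]
  · simp [xvec, h]
  · simp [xvec, h, h.not_gt]

theorem pair_eq_or_eq_swap {α : Type*} [DecidableEq α] {p q : α × α}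
    (h : ({p.1, p.2} : Finset α) = {q.1, q.2}) : p = q ∨ p = (q.2, q.1) := by
  have h' : ({p.1, p.2} : Set α) = {q.1, q.2} := by
    simpa only [Finset.coe_insert, Finset.coe_singleton] using
      congrArg (SetLike.coe (A := Finset α)) h
  rcases Set.pair_eq_pair_iff.1 h' with ⟨h1, h2⟩ | ⟨h1, h2⟩
  · exact Or.inl (Prod.ext h1 h2)
  · exact Or.inr (Prod.ext h1 h2)

theorem pMono_eq_prod {C A : Type*} [CommRing C] [Ring A] [Algebra C A] (w : Fin 5 → C) {n : ℕ}
    (I : Fin n → Fin 5 × Fin 5) (S : Finset (Fin n × Fin n)) :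
    pMono (fun t => algebraMap C A (w t)) (pCount I S) =
      algebraMap C A (∏ q ∈ S, w (tIdx (I q.1).1 (I q.1).2 (I q.2).1 (I q.2).2)) := by
  rw [← Finset.prod_fiberwise S fun q => tIdx (I q.1).1 (I q.1).2 (I q.2).1 (I q.2).2]
  have h : ∀ t, ∏ q ∈ S with tIdx (I q.1).1 (I q.1).2 (I q.2).1 (I q.2).2 = t,
      w (tIdx (I q.1).1 (I q.1).2 (I q.2).1 (I q.2).2) = w t ^ pCount I S t := fun t =>
    Finset.prod_eq_pow_card fun q hq => by rw [(Finset.mem_filter.1 hq).2]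
  simp_rw [h, Fin.prod_univ_five, map_mul, map_pow]
  rfl

variable {A : Type*} [Ring A] [Algebra ℂ A]

theorem map_omegaOf {A' : Type*} [Ring A'] [Algebra ℂ A'] (φ : A' →ₐ[ℂ] A)
    (dd : Fin 5 → Fin 5 → A') (pp : Fin 5 → A') {n : ℕ} (I : Fin n → Fin 5 × Fin 5) :
    φ (omegaOf dd pp I) = omegaOf (fun i j => φ (dd i j)) (fun t => φ (pp t)) I := by
  simp only [omegaOf, map_sum, apply_ite φ, map_zero, omegaBody, map_smul, map_mul, pMono, map_pow,
    dRest, map_list_prod, List.map_map]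
  rfl

theorem E510Rep.d_self (R : E510Rep A) (i : Fin 5) : R.d i i = 0 := by
  have h := R.d_antisymm i i
  have h2 : (2 : ℂ) • R.d i i = 0 := by
    rw [two_smul]
    nth_rewrite 1 [h]
    simp
  simpa using h2

/-- A linear map out of `C ⊗ V10` with value `R.d i j` at each `x_{(i,j)}`. -/
def E510Rep.linearD (R : E510Rep A) (C : Type*) [CommRing C] [Algebra C A] :
    ({q : Fin 5 × Fin 5 // q.1 < q.2} → C) →ₗ[C] A :=
  Fintype.linearCombination C fun q => R.d q.1.1 q.1.2

/-- Extension of scalars on coordinates. -/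
def scalarExt (C : Type*) [CommRing C] [Algebra ℂ C] :
    V10 →ₗ[ℂ] ({q : Fin 5 × Fin 5 // q.1 < q.2} → C) :=
  (Algebra.linearMap ℂ C).compLeft _

theorem E510Rep.linearD_scalarExt_xvec (R : E510Rep A) (C : Type*) [CommRing C] [Algebra ℂ C]
    [Algebra C A] (q : Fin 5 × Fin 5) :
    R.linearD C (scalarExt C (xvec q)) = R.d q.1 q.2 := by
  have key : ∀ p : {q : Fin 5 × Fin 5 // q.1 < q.2},
      R.linearD C (scalarExt C (Pi.single p 1)) = R.d p.1.1 p.1.2 := by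
    intro p
    have h : scalarExt C (Pi.single p 1) = Pi.single p 1 := by
      ext i
      by_cases hi : i = p
      · subst hi; simp [scalarExt]
      · simp [scalarExt, hi]
    rw [h, E510Rep.linearD, Fintype.linearCombination_apply_single, one_smul]
  unfold xvec
  split_ifs with h1 h2
  · exact key _
  · rw [map_neg, map_neg, key, ← R.d_antisymm]
  · have h : q.1 = q.2 := le_antisymm (not_lt.1 h2) (not_lt.1 h1)
    rw [map_zero, map_zero, h, R.d_self]

theorem omegaOf_eq_matchingSum {C : Type*} [CommRing C] [Algebra ℂ C] [Algebra C A]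
    [IsScalarTower ℂ C A] (dd : Fin 5 → Fin 5 → A) (w : Fin 5 → C) {n : ℕ}
    (I : Fin n → Fin 5 × Fin 5) :
    omegaOf dd (fun t => algebraMap C A (w t)) I =
      matchingSum (fun i => dd (I i).1 (I i).2) (fun i j =>
        (((eps (I i).1 (I i).2 (I j).1 (I j).2 : ℤ) : ℂ) / 2) •
          w (tIdx (I i).1 (I i).2 (I j).1 (I j).2)) := by
  rw [omegaOf, matchingSum, Finset.sum_filter]
  refine Finset.sum_congr rfl fun S _ => ?_
  congr 1
  rw [omegaBody, pMono_eq_prod, ← Algebra.smul_def, ← smul_assoc]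
  congr 1
  rw [matchingWeight, DScalar, Algebra.smul_def, map_mul, map_pow, map_neg, map_one, map_prod,
    mul_assoc, ← Finset.prod_mul_distrib]
  congr 1
  refine Finset.prod_congr rfl fun q _ => ?_
  rw [mul_div_assoc, map_mul, map_pow, map_neg, map_one, Algebra.smul_def, mul_assoc]

/-- The bilinear form with values `½ ε ∂` on the basis vectors `x_{(i,j)}`. -/
def epsForm {C : Type*} [CommRing C] [Algebra ℂ C] (w : Fin 5 → C) :
    LinearMap.BilinForm C ({q : Fin 5 × Fin 5 // q.1 < q.2} → C) :=
  Matrix.toBilin' (Matrix.of fun p q => (((eps p.1.1 p.1.2 q.1.1 q.1.2 : ℤ) : ℂ) / 2) •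
    w (tIdx p.1.1 p.1.2 q.1.1 q.1.2))

section Central

variable {C : Type*} [CommRing C] [Algebra ℂ C] [Algebra C A] [IsScalarTower ℂ C A]

theorem E510Rep.smul_eps (R : E510Rep A) {w : Fin 5 → C} (hw : ∀ t, algebraMap C A (w t) = R.p t)
    (i j k l : Fin 5) :
    algebraMap C A ((((eps i j k l : ℤ) : ℂ) / 2) • w (tIdx i j k l)) =
      (2⁻¹ : ℂ) • (R.d i j * R.d k l + R.d k l * R.d i j) := by
  rw [R.dd_rel, ← hw, Algebra.algebraMap_eq_smul_one, smul_assoc, ← Algebra.algebraMap_eq_smul_one,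
    ← Int.cast_smul_eq_zsmul ℂ, smul_smul, div_eq_inv_mul]

theorem E510Rep.linearD_anticomm (R : E510Rep A) {w : Fin 5 → C}
    (hw : ∀ t, algebraMap C A (w t) = R.p t) (x y : {q : Fin 5 × Fin 5 // q.1 < q.2} → C) :
    algebraMap C A (epsForm w x y) =
      (2⁻¹ : ℂ) • (R.linearD C x * R.linearD C y + R.linearD C y * R.linearD C x) := by
  rw [← algebraMap_smul C (2⁻¹ : ℂ)]
  let P : ({q : Fin 5 × Fin 5 // q.1 < q.2} → C) →ₗ[C]
      ({q : Fin 5 × Fin 5 // q.1 < q.2} → C) →ₗ[C] A :=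
    (LinearMap.mul C A).compl₁₂ (R.linearD C) (R.linearD C)
  have h : (epsForm w).compr₂ (Algebra.linearMap C A) = (algebraMap ℂ C 2⁻¹) • (P + P.flip) := by
    refine LinearMap.ext_basis (Pi.basisFun C _) (Pi.basisFun C _) fun p q => ?_
    simp only [Pi.basisFun_apply, LinearMap.compr₂_apply, LinearMap.smul_apply, LinearMap.add_apply,
      LinearMap.flip_apply, P, LinearMap.compl₁₂_apply, LinearMap.mul_apply', E510Rep.linearD,
      Fintype.linearCombination_apply_single, one_smul, epsForm, Matrix.toBilin'_single,
      Matrix.of_apply, Algebra.linearMap_apply, R.smul_eps hw, algebraMap_smul]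
  exact LinearMap.congr_fun₂ h x y

theorem E510Rep.epsForm_xvec (R : E510Rep A) {w : Fin 5 → C}
    (hw : ∀ t, algebraMap C A (w t) = R.p t) (hinj : Function.Injective (algebraMap C A))
    (p q : Fin 5 × Fin 5) :
    epsForm w (scalarExt C (xvec p)) (scalarExt C (xvec q)) =
      (((eps p.1 p.2 q.1 q.2 : ℤ) : ℂ) / 2) • w (tIdx p.1 p.2 q.1 q.2) := by
  apply hinj
  rw [R.linearD_anticomm hw, R.smul_eps hw, R.linearD_scalarExt_xvec, R.linearD_scalarExt_xvec]

theorem E510Rep.exists_linearMap_of_central (R : E510Rep A) {w : Fin 5 → C}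
    (hw : ∀ t, algebraMap C A (w t) = R.p t) (hinj : Function.Injective (algebraMap C A)) :
    ∃ f : ExteriorAlgebra ℂ V10 →ₗ[ℂ] A, ∀ (n : ℕ) (I : Fin n → Fin 5 × Fin 5),
      f (xwedge I) = omegaOf R.d R.p I := by
  obtain ⟨g, hg1, hg⟩ := exists_wick_map (R.linearD C) (epsForm w) fun x => by
    rw [R.linearD_anticomm hw, ← two_smul ℂ, smul_smul]
    norm_num
  let φ : ExteriorAlgebra ℂ V10 →ₐ[ℂ]
      ExteriorAlgebra C ({q : Fin 5 × Fin 5 // q.1 < q.2} → C) :=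
    ExteriorAlgebra.lift ℂ ⟨(ExteriorAlgebra.ι C).restrictScalars ℂ ∘ₗ scalarExt C,
      fun m => ExteriorAlgebra.ι_sq_zero _⟩
  have hφ : ∀ {n : ℕ} (I : Fin n → Fin 5 × Fin 5), φ (xwedge I) =
      (List.ofFn fun i => ExteriorAlgebra.ι C (scalarExt C (xvec (I i)))).prod := by
    intro n I
    rw [xwedge, map_list_prod, List.map_ofFn]
    congr 2
    funext i
    exact ExteriorAlgebra.lift_ι_apply ℂ _ _ _
  have hp : R.p = fun t => algebraMap C A (w t) := funext fun t => (hw t).symm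
  refine ⟨g.restrictScalars ℂ ∘ₗ φ.toLinearMap, fun n => ?_⟩
  have main : ∀ n (I : Fin n → Fin 5 × Fin 5),
      g (List.ofFn fun i => ExteriorAlgebra.ι C (scalarExt C (xvec (I i)))).prod =
        matchingSum (fun i => R.d (I i).1 (I i).2) (fun i j =>
          (((eps (I i).1 (I i).2 (I j).1 (I j).2 : ℤ) : ℂ) / 2) •
            w (tIdx (I i).1 (I i).2 (I j).1 (I j).2)) := by
    intro n
    induction n using Nat.strong_induction_on with
    | _ n ih =>
      intro I
      match n with
      | 0 => simp [matchingSum_zero, hg1]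
      | 1 =>
        rw [matchingSum_one, List.ofFn_succ, List.prod_cons, hg, List.ofFn_zero, List.prod_nil,
          CliffordAlgebra.contractLeft_one, hg1, R.linearD_scalarExt_xvec]
        simp
      | n + 2 =>
        rw [matchingSum_succ_succ, List.ofFn_succ, List.prod_cons, hg, contractLeft_prod_ofFn,
          map_sum, ih (n + 1) (by omega) (fun i => I i.succ), R.linearD_scalarExt_xvec,
          sub_eq_add_neg, ← Finset.sum_neg_distrib]
        congr 1
        refine Finset.sum_congr rfl fun l _ => ?_
        rw [map_smul, ih n (by omega) (fun i => I (l.succAbove i).succ), R.epsForm_xvec hw hinj,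
          ← neg_smul, pow_succ]
        congr 1
        ring
  intro I
  rw [LinearMap.comp_apply, AlgHom.toLinearMap_apply, hφ, LinearMap.restrictScalars_apply, main,
    hp, omegaOf_eq_matchingSum]

end Central

theorem E510Rep.exists_linearMap_of_mem_center (R : E510Rep A)
    (h : ∀ t, R.p t ∈ Subalgebra.center ℂ A) :
    ∃ f : ExteriorAlgebra ℂ V10 →ₗ[ℂ] A, ∀ (n : ℕ) (I : Fin n → Fin 5 × Fin 5),
      f (xwedge I) = omegaOf R.d R.p I := by
  let : Algebra (Subalgebra.center ℂ A) A :=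
    { algebraMap := (Subalgebra.center ℂ A).val.toRingHom
      commutes' := fun c x => (Subalgebra.mem_center_iff.1 c.2 x).symm
      smul_def' := fun _ _ => rfl }
  have : IsScalarTower ℂ (Subalgebra.center ℂ A) A := IsScalarTower.of_algebraMap_eq fun _ => rfl
  exact R.exists_linearMap_of_central (C := Subalgebra.center ℂ A) (w := fun t => ⟨R.p t, h t⟩)
    (fun _ => rfl) Subtype.val_injective

/-- The generators, as elements of the subalgebra they generate. -/
def E510Rep.toAdjoin (R : E510Rep A) :
    E510Rep (Algebra.adjoin ℂ (Set.range R.p ∪ Set.range fun q : Fin 5 × Fin 5 => R.d q.1 q.2))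
    where
  d i j := ⟨R.d i j, Algebra.subset_adjoin (Or.inr ⟨(i, j), rfl⟩)⟩
  p t := ⟨R.p t, Algebra.subset_adjoin (Or.inl ⟨t, rfl⟩)⟩
  d_antisymm i j := Subtype.ext (R.d_antisymm i j)
  pd_comm t i j := Subtype.ext (R.pd_comm t i j)
  pp_comm s t := Subtype.ext (R.pp_comm s t)
  dd_rel i j k l := Subtype.ext (by simpa using R.dd_rel i j k l)

theorem E510Rep.toAdjoin_p_mem_center (R : E510Rep A) (t : Fin 5) :
    R.toAdjoin.p t ∈ Subalgebra.center ℂ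
      (Algebra.adjoin ℂ (Set.range R.p ∪ Set.range fun q : Fin 5 × Fin 5 => R.d q.1 q.2)) := by
  rw [Subalgebra.mem_center_iff]
  rintro ⟨x, hx⟩
  apply Subtype.ext
  change x * R.p t = R.p t * x
  have hle : Algebra.adjoin ℂ (Set.range R.p ∪ Set.range fun q : Fin 5 × Fin 5 => R.d q.1 q.2) ≤
      Subalgebra.centralizer ℂ {R.p t} := by
    rw [Algebra.adjoin_le_iff]
    rintro _ (⟨s, rfl⟩ | ⟨q, rfl⟩)
    · exact (Subalgebra.mem_centralizer_iff ℂ).2 fun _ h => h ▸ R.pp_comm t s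
    · exact (Subalgebra.mem_centralizer_iff ℂ).2 fun _ h => h ▸ R.pd_comm t q.1 q.2
  exact (Subalgebra.mem_centralizer_iff ℂ |>.1 (hle hx) _ rfl).symm

theorem E510Rep.exists_linearMap (R : E510Rep A) :
    ∃ f : ExteriorAlgebra ℂ V10 →ₗ[ℂ] A, ∀ (n : ℕ) (I : Fin n → Fin 5 × Fin 5),
      f (xwedge I) = omegaOf R.d R.p I := by
  obtain ⟨f, hf⟩ := R.toAdjoin.exists_linearMap_of_mem_center R.toAdjoin_p_mem_center
  refine ⟨(Subalgebra.val _).toLinearMap ∘ₗ f, fun n I => ?_⟩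
  rw [LinearMap.comp_apply, hf, AlgHom.toLinearMap_apply, map_omegaOf]
  rfl

end Omega

/-- `ω` is alternating: (i) permuting the entries of `I` multiplies `ω_I` by the sign of the
permutation; (ii) reversing one ordered pair changes the sign; (iii) `ω_I = 0` if two entries
coincide as `2`-element subsets; consequently `x_{I_1} ∧ ⋯ ∧ x_{I_d} ↦ ω_I` extends to a
well-defined `ℂ`-linear map on `Λ^d V`. -/
theorem omega_alternating {A : Type*} [Ring A] [Algebra ℂ A] (R : E510Rep A) (d : ℕ) :
    (∀ (I : Fin d → Fin 5 × Fin 5) (σ : Equiv.Perm (Fin d)),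
        omegaOf R.d R.p (fun a => I (σ a)) = (Equiv.Perm.sign σ : ℤ) • omegaOf R.d R.p I)
      ∧ (∀ (I : Fin d → Fin 5 × Fin 5) (l : Fin d),
          omegaOf R.d R.p (Function.update I l ((I l).2, (I l).1)) = -omegaOf R.d R.p I)
      ∧ (∀ I : Fin d → Fin 5 × Fin 5,
          (∃ a b : Fin d, a ≠ b ∧
              ({(I a).1, (I a).2} : Finset (Fin 5)) = {(I b).1, (I b).2}) →
            omegaOf R.d R.p I = 0)
      ∧ ∃ f : ExteriorAlgebra ℂ V10 →ₗ[ℂ] A,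
          ∀ I : Fin d → Fin 5 × Fin 5, f (xwedge I) = omegaOf R.d R.p I := by
  obtain ⟨f, hf⟩ := R.exists_linearMap
  have hω : ∀ I : Fin d → Fin 5 × Fin 5, omegaOf R.d R.p I =
      f (ExteriorAlgebra.ιMulti ℂ d fun a => xvec (I a)) := fun I => by
    rw [← hf, xwedge_eq_ιMulti]
  refine ⟨fun I σ => ?_, fun I l => ?_, ?_, f, hf d⟩
  · rw [hω, hω, ← map_zsmul]
    congr 1
    exact (ExteriorAlgebra.ιMulti ℂ d).map_perm (fun a => xvec (I a)) σ
  · rw [hω, hω, ← map_neg]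
    congr 1
    have h : (fun a => xvec (Function.update I l ((I l).2, (I l).1) a)) =
        Function.update (fun a => xvec (I a)) l (-xvec (I l)) := by
      rw [← xvec_swap]
      exact Function.comp_update xvec I l _
    rw [h, AlternatingMap.map_update_neg, Function.update_eq_self]
  · rintro I ⟨a, b, hab, h⟩
    rw [hω]
    rcases pair_eq_or_eq_swap h with h | h
    · rw [(ExteriorAlgebra.ιMulti ℂ d).map_eq_zero_of_eq _ (congrArg xvec h) hab, map_zero]
    · have hx : xvec (I a) = -xvec (I b) := by rw [h, xvec_swap]
      have hu : (fun c => xvec (I c)) =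
          Function.update (fun c => xvec (I c)) a (-xvec (I b)) := by
        rw [← hx, Function.update_eq_self]
      rw [hu, AlternatingMap.map_update_neg, (ExteriorAlgebra.ιMulti ℂ d).map_update_self _ hab,
        neg_zero, map_zero]

end
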